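/- For a fixed victim policy π on a finite MDP, the set 𝒟_{π∘ν} = { ρ̂_{π∘ν} : ν an adversarial policy } ⊆ ℝ^{S×A} of occupancy measures of composite policies is a convex subset of ℝ^{S×A}: for any adversarial policies ν₁, ν₂ and any λ ∈ [0,1], there exists an adversarial policy ν with ρ̂_{π∘ν} = λ·ρ̂_{π∘ν₁} + (1−λ)·ρ̂_{π∘ν₂}. -/

import Mathlib

open scoped BigOperators ENNReal

/-- A probability mass function on a finite type, as a real-valued function. -/
def IsPMF {X : Type*} [Fintype X] (q : X → ℝ) : Prop :=
  (∀ x, 0 ≤ q x) ∧ ∑ x, q x = 1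

/-- The composite policy `π∘ν`: `(π∘ν)(a|s) = Σ_ŝ ν(ŝ|s) π(a|ŝ)`. -/
def comp {S A : Type*} [Fintype S] (π : S → A → ℝ) (ν : S → S → ℝ) : S → A → ℝ :=
  fun s a => ∑ sh, ν s sh * π sh a

/-- Time-`t` state distribution of policy `π` with transitions `p`, started from `d0`. -/
def stateDist {S A : Type*} [Fintype S] [Fintype A] (π : S → A → ℝ)
    (p : S → A → S → ℝ) (d0 : S → ℝ) : ℕ → S → ℝ
  | 0 => d0
  | (t + 1) => fun s' => ∑ s, stateDist π p d0 t s * ∑ a, π s a * p s a s'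

/-- Expected one-step reward from state distribution `d`. -/
def stepReward {S A : Type*} [Fintype S] [Fintype A] (π : S → A → ℝ)
    (p : S → A → S → ℝ) (R : S → A → S → ℝ) (d : S → ℝ) : ℝ :=
  ∑ s, d s * ∑ a, π s a * ∑ s', p s a s' * R s a s'

/-- Expected discounted return `E[Σ_t γ^t R(s_t,a_t,s_{t+1})]` started from distribution `d0`. -/
noncomputable def valueFrom {S A : Type*} [Fintype S] [Fintype A] (γ : ℝ)
    (π : S → A → ℝ) (p : S → A → S → ℝ) (R : S → A → S → ℝ) (d0 : S → ℝ) : ℝ :=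
  ∑' t : ℕ, γ ^ t * stepReward π p R (stateDist π p d0 t)

/-- Value function: expected discounted return started from state `s0`. -/
noncomputable def value {S A : Type*} [Fintype S] [Fintype A] [DecidableEq S] (γ : ℝ)
    (π : S → A → ℝ) (p : S → A → S → ℝ) (R : S → A → S → ℝ) (s0 : S) : ℝ :=
  valueFrom γ π p R (fun x => if x = s0 then 1 else 0)

/-- Transition kernel of the constructed MDP `M̂`: `p̂(s'|s,ŝ) = Σ_a π(a|ŝ) p(s'|s,a)`. -/
def phat {S A : Type*} [Fintype A] (π : S → A → ℝ) (p : S → A → S → ℝ) :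
    S → S → S → ℝ :=
  fun s sh s' => ∑ a, π sh a * p s a s'

/-- The point-mass (deterministic) adversarial policy associated to `f : S → S`. -/
def detPol {S : Type*} [DecidableEq S] (f : S → S) : S → S → ℝ :=
  fun s sh => if sh = f s then 1 else 0

open Classical in
/-- Kullback–Leibler divergence of finite pmfs, `+∞` when not absolutely continuous. -/
noncomputable def KL {X : Type*} [Fintype X] (P Q : X → ℝ) : ℝ≥0∞ :=
  if ∀ x, 0 < P x → 0 < Q x then ENNReal.ofReal (∑ x, P x * Real.log (P x / Q x)) else ⊤

/-- Normalized discounted state distribution `d_π = (1-γ) Σ_t γ^t d_π^t`. -/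
noncomputable def dDisc {S A : Type*} [Fintype S] [Fintype A] (γ : ℝ) (π : S → A → ℝ)
    (p : S → A → S → ℝ) (p0 : S → ℝ) : S → ℝ :=
  fun s => (1 - γ) * ∑' t : ℕ, γ ^ t * stateDist π p p0 t s

/-- Normalized discounted state–action distribution `ρ_π(s,a) = d_π(s) π(a|s)`. -/
noncomputable def rho {S A : Type*} [Fintype S] [Fintype A] (γ : ℝ) (π : S → A → ℝ)
    (p : S → A → S → ℝ) (p0 : S → ℝ) : S × A → ℝ :=
  fun z => dDisc γ π p p0 z.1 * π z.1 z.2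

/-- Unnormalized occupancy measure `ρ̂_π(s,a) = Σ_t γ^t Pr(s_t=s, a_t=a)`. -/
noncomputable def occ {S A : Type*} [Fintype S] [Fintype A] (γ : ℝ) (π : S → A → ℝ)
    (p : S → A → S → ℝ) (p0 : S → ℝ) : S × A → ℝ :=
  fun z => ∑' t : ℕ, γ ^ t * (stateDist π p p0 t z.1 * π z.1 z.2)

/-- Expected discounted cost `E_π[c] = Σ_{s,a} ρ̂_π(s,a) c(s,a)`. -/
noncomputable def Ecost {S A : Type*} [Fintype S] [Fintype A] (γ : ℝ) (π : S → A → ℝ)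
    (p : S → A → S → ℝ) (p0 : S → ℝ) (c : S × A → ℝ) : ℝ :=
  ∑ z : S × A, occ γ π p p0 z * c z

/-- Convex conjugate of `ψ` restricted to the set `C`. -/
noncomputable def psiStar {X : Type*} [Fintype X] (C : Set ((X → ℝ))) (ψ : (X → ℝ) → ℝ)
    (x : X → ℝ) : ℝ :=
  sSup ((fun c => (∑ z, x z * c z) - ψ c) '' C)

lemma aux_comp {S A : Type*} [Fintype S] [Fintype A]
    (π : S → A → ℝ) (hπ : ∀ s, IsPMF (π s)) (ν : S → S → ℝ) (hν : ∀ s, IsPMF (ν s)) (s : S) :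
    IsPMF (comp π ν s) := by
  refine ⟨fun a => Finset.sum_nonneg fun x _ => mul_nonneg ((hν s).1 x) ((hπ x).1 a), ?_⟩
  unfold comp
  rw [Finset.sum_comm]
  simp_rw [← Finset.mul_sum, (hπ _).2, mul_one]
  exact (hν s).2

lemma aux_kernel {S A : Type*} [Fintype S] [Fintype A]
    (q : S → A → ℝ) (hq : ∀ s, IsPMF (q s))
    (p : S → A → S → ℝ) (hp : ∀ s a, IsPMF (p s a)) (s : S) :
    IsPMF (fun s' => ∑ a, q s a * p s a s') := by
  refine ⟨fun s' => Finset.sum_nonneg fun a _ => mul_nonneg ((hq s).1 a) ((hp s a).1 s'), ?_⟩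
  rw [Finset.sum_comm]
  simp_rw [← Finset.mul_sum, (hp _ _).2, mul_one]
  exact (hq s).2

lemma aux_sd {S A : Type*} [Fintype S] [Fintype A]
    (p0 : S → ℝ) (hp0 : IsPMF p0) (q : S → A → ℝ) (hq : ∀ s, IsPMF (q s))
    (p : S → A → S → ℝ) (hp : ∀ s a, IsPMF (p s a)) (t : ℕ) :
    IsPMF (stateDist q p p0 t) := by
  induction t with
  | zero => exact hp0
  | succ t ih =>
    refine ⟨fun s' => Finset.sum_nonneg fun s _ =>
      mul_nonneg (ih.1 s) ((aux_kernel q hq p hp s).1 s'), ?_⟩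
    simp only [stateDist]
    rw [Finset.sum_comm]
    simp_rw [← Finset.mul_sum]
    rw [← ih.2]
    exact Finset.sum_congr rfl fun s _ => by rw [(aux_kernel q hq p hp s).2, mul_one]

lemma aux_summable {S A : Type*} [Fintype S] [Fintype A]
    (γ : ℝ) (hγ0 : 0 < γ) (hγ1 : γ < 1)
    (p0 : S → ℝ) (hp0 : IsPMF p0) (q : S → A → ℝ) (hq : ∀ s, IsPMF (q s))
    (p : S → A → S → ℝ) (hp : ∀ s a, IsPMF (p s a)) (s : S) :
    Summable (fun t : ℕ => γ ^ t * stateDist q p p0 t s) := by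
  refine Summable.of_nonneg_of_le (fun t => ?_) (fun t => ?_)
    (summable_geometric_of_lt_one hγ0.le hγ1)
  · exact mul_nonneg (pow_nonneg hγ0.le t) ((aux_sd p0 hp0 q hq p hp t).1 s)
  · have h := aux_sd p0 hp0 q hq p hp t
    have : stateDist q p p0 t s ≤ 1 := by
      rw [← h.2]
      exact Finset.single_le_sum (fun x _ => h.1 x) (Finset.mem_univ s)
    exact mul_le_of_le_one_right (pow_nonneg hγ0.le t) this

/-- Unnormalized discounted state visitation. -/
noncomputable def visit {S A : Type*} [Fintype S] [Fintype A] (γ : ℝ) (q : S → A → ℝ)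
    (p : S → A → S → ℝ) (p0 : S → ℝ) (s : S) : ℝ :=
  ∑' t : ℕ, γ ^ t * stateDist q p p0 t s

lemma occ_visit {S A : Type*} [Fintype S] [Fintype A] (γ : ℝ) (q : S → A → ℝ)
    (p : S → A → S → ℝ) (p0 : S → ℝ) (z : S × A) :
    occ γ q p p0 z = visit γ q p p0 z.1 * q z.1 z.2 := by
  unfold occ visit
  simp_rw [← mul_assoc]
  rw [tsum_mul_right]

lemma visit_flow {S A : Type*} [Fintype S] [Fintype A]
    (γ : ℝ) (hγ0 : 0 < γ) (hγ1 : γ < 1)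
    (p0 : S → ℝ) (hp0 : IsPMF p0) (q : S → A → ℝ) (hq : ∀ s, IsPMF (q s))
    (p : S → A → S → ℝ) (hp : ∀ s a, IsPMF (p s a)) (s' : S) :
    visit γ q p p0 s' = p0 s' + γ * ∑ s, visit γ q p p0 s * ∑ a, q s a * p s a s' := by
  have hs := aux_summable γ hγ0 hγ1 p0 hp0 q hq p hp
  conv_lhs => unfold visit
  rw [(hs s').tsum_eq_zero_add]
  congr 1
  · simp [stateDist]
  · unfold visit
    simp_rw [← tsum_mul_right]
    rw [← Summable.tsum_finsetSum (fun s _ => (hs s).mul_right _), ← tsum_mul_left]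
    refine tsum_congr fun t => ?_
    simp only [stateDist, Finset.mul_sum]
    refine Finset.sum_congr rfl fun s _ => Finset.sum_congr rfl fun a _ => ?_
    ring

lemma flow_unique {S : Type*} [Fintype S] (γ : ℝ) (hγ0 : 0 < γ) (hγ1 : γ < 1)
    (K : S → S → ℝ) (hK : ∀ s, IsPMF (K s)) (b x y : S → ℝ)
    (hx : ∀ s', x s' = b s' + γ * ∑ s, x s * K s s')
    (hy : ∀ s', y s' = b s' + γ * ∑ s, y s * K s s') : x = y := by
  have h1 : ∀ s', |x s' - y s'| ≤ γ * ∑ s, |x s - y s| * K s s' := by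
    intro s'
    have : x s' - y s' = γ * ∑ s, (x s - y s) * K s s' := by
      rw [hx s', hy s']
      simp_rw [sub_mul]
      rw [Finset.sum_sub_distrib]
      ring
    rw [this, abs_mul, abs_of_pos hγ0]
    refine mul_le_mul_of_nonneg_left ?_ hγ0.le
    refine (Finset.abs_sum_le_sum_abs _ _).trans (le_of_eq ?_)
    exact Finset.sum_congr rfl fun s _ => by rw [abs_mul, abs_of_nonneg ((hK s).1 s')]
  have h2 : ∑ s', |x s' - y s'| ≤ γ * ∑ s, |x s - y s| := by
    refine (Finset.sum_le_sum fun s' _ => h1 s').trans (le_of_eq ?_)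
    rw [← Finset.mul_sum, Finset.sum_comm]
    simp_rw [← Finset.mul_sum, (hK _).2, mul_one]
  have h3 : 0 ≤ ∑ s, |x s - y s| := Finset.sum_nonneg fun s _ => abs_nonneg _
  have h4 : ∑ s, |x s - y s| = 0 := by nlinarith
  funext s
  have := (Finset.sum_eq_zero_iff_of_nonneg (fun s _ => abs_nonneg (x s - y s))).1 h4 s
    (Finset.mem_univ s)
  exact sub_eq_zero.1 (abs_eq_zero.1 this)

/-- the set of occupancy measures of composite policies is convex: any mixture of
two such occupancy measures is realized by some adversarial policy. -/
theorem stmt12 {S A : Type*} [Fintype S] [Fintype A] [Nonempty S] [Nonempty A]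
    (γ : ℝ) (hγ0 : 0 < γ) (hγ1 : γ < 1)
    (p0 : S → ℝ) (hp0 : IsPMF p0)
    (π : S → A → ℝ) (hπ : ∀ s, IsPMF (π s))
    (p : S → A → S → ℝ) (hp : ∀ s a, IsPMF (p s a))
    (ν₁ ν₂ : S → S → ℝ) (hν₁ : ∀ s, IsPMF (ν₁ s)) (hν₂ : ∀ s, IsPMF (ν₂ s))
    (lam : ℝ) (hlam : lam ∈ Set.Icc (0 : ℝ) 1) :
    ∃ ν : S → S → ℝ, (∀ s, IsPMF (ν s)) ∧
      occ γ (comp π ν) p p0 =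
        fun z => lam * occ γ (comp π ν₁) p p0 z + (1 - lam) * occ γ (comp π ν₂) p p0 z := by
  classical
  obtain ⟨hl0, hl1⟩ := hlam
  have hl1' : 0 ≤ 1 - lam := by linarith
  have hq₁ := aux_comp π hπ ν₁ hν₁
  have hq₂ := aux_comp π hπ ν₂ hν₂
  obtain ⟨D1, hD1⟩ : ∃ D, D = visit γ (comp π ν₁) p p0 := ⟨_, rfl⟩
  obtain ⟨D2, hD2⟩ : ∃ D, D = visit γ (comp π ν₂) p p0 := ⟨_, rfl⟩
  have f1 := visit_flow γ hγ0 hγ1 p0 hp0 _ hq₁ p hp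
  have f2 := visit_flow γ hγ0 hγ1 p0 hp0 _ hq₂ p hp
  have n1 : ∀ s, 0 ≤ D1 s := fun s => by
    rw [hD1]
    exact tsum_nonneg fun t => mul_nonneg (pow_nonneg hγ0.le t) ((aux_sd p0 hp0 _ hq₁ p hp t).1 s)
  have n2 : ∀ s, 0 ≤ D2 s := fun s => by
    rw [hD2]
    exact tsum_nonneg fun t => mul_nonneg (pow_nonneg hγ0.le t) ((aux_sd p0 hp0 _ hq₂ p hp t).1 s)
  rw [← hD1] at f1
  rw [← hD2] at f2
  obtain ⟨D, hD⟩ : ∃ D : S → ℝ, ∀ s, D s = lam * D1 s + (1 - lam) * D2 s := ⟨_, fun _ => rfl⟩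
  have nD : ∀ s, 0 ≤ D s := fun s => by
    rw [hD]
    exact add_nonneg (mul_nonneg hl0 (n1 s)) (mul_nonneg hl1' (n2 s))
  obtain ⟨ν, hν⟩ : ∃ ν : S → S → ℝ, ∀ s, IsPMF (ν s) ∧ ∀ x, D s * ν s x =
      lam * D1 s * ν₁ s x + (1 - lam) * D2 s * ν₂ s x := by
    have : ∀ s, ∃ r : S → ℝ, IsPMF r ∧ ∀ x, D s * r x =
      lam * D1 s * ν₁ s x + (1 - lam) * D2 s * ν₂ s x := by
      intro s
      have a1 := mul_nonneg hl0 (n1 s)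
      have a2 := mul_nonneg hl1' (n2 s)
      by_cases h : D s = 0
      · refine ⟨ν₁ s, hν₁ s, fun x => ?_⟩
        have h' := hD s
        have e1 : lam * D1 s = 0 := by linarith
        have e2 : (1 - lam) * D2 s = 0 := by linarith
        rw [h, e1, e2]
        ring
      · refine ⟨fun x => (lam * D1 s * ν₁ s x + (1 - lam) * D2 s * ν₂ s x) / D s,
          ⟨fun x => ?_, ?_⟩, fun x => ?_⟩
        · exact div_nonneg (add_nonneg (mul_nonneg a1 ((hν₁ s).1 x))
            (mul_nonneg a2 ((hν₂ s).1 x))) (nD s)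
        · rw [← Finset.sum_div, Finset.sum_add_distrib, ← Finset.mul_sum, ← Finset.mul_sum,
            (hν₁ s).2, (hν₂ s).2, mul_one, mul_one, ← hD, div_self h]
        · exact mul_div_cancel₀ _ h
    choose ν hν using this
    exact ⟨ν, hν⟩
  have hc : ∀ s a, D s * comp π ν s a =
      lam * (D1 s * comp π ν₁ s a) + (1 - lam) * (D2 s * comp π ν₂ s a) := by
    intro s a
    simp only [comp, Finset.mul_sum]
    rw [← Finset.sum_add_distrib]
    refine Finset.sum_congr rfl fun x _ => ?_
    rw [← mul_assoc, (hν s).2 x]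
    ring
  have hq := aux_comp π hπ ν (fun s => (hν s).1)
  have hDv : D = visit γ (comp π ν) p p0 := by
    refine flow_unique γ hγ0 hγ1 _ (aux_kernel _ hq p hp) p0 _ _ (fun s' => ?_)
      (visit_flow γ hγ0 hγ1 p0 hp0 _ hq p hp)
    have : ∑ s, D s * ∑ a, comp π ν s a * p s a s' =
        lam * (∑ s, D1 s * ∑ a, comp π ν₁ s a * p s a s') +
        (1 - lam) * (∑ s, D2 s * ∑ a, comp π ν₂ s a * p s a s') := by
      simp only [Finset.mul_sum]
      rw [← Finset.sum_add_distrib]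
      refine Finset.sum_congr rfl fun s _ => ?_
      rw [← Finset.sum_add_distrib]
      refine Finset.sum_congr rfl fun a _ => ?_
      rw [← mul_assoc, hc]
      ring
    rw [this, hD, f1 s', f2 s']
    ring
  refine ⟨ν, fun s => (hν s).1, ?_⟩
  funext z
  rw [occ_visit, occ_visit, occ_visit, ← hDv, ← hD1, ← hD2, hc]
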